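/- arXiv:2402.05718 — 2 statements merged into one kernel-verified Lean document; each statement's English description precedes it below -/
import Mathlib

section
/- Let P be a probability measure on ℝ^d, let f : ℝ^d → ℝ be bounded and continuous, and let ε > 0. Then there exists a two-hidden-layer ReLU network T : ℝ^d → ℝ such that E^P[|f − T|] < ε. Moreover, if sup_x |f(x)| ≤ M' − 1 for some M' ≥ 1, then T can be chosen so that additionally sup_x |T(x)| ≤ M'. -/
open MeasureTheory
open scoped RealInnerProductSpace BigOperators

/-- A two-hidden-layer ReLU network `ℝ^d → ℝ`:
`T(x) = c + Σ_j λ_j · max(0, b_j + Σ_i w_{ji} · max(0, ⟨β_i, x⟩ + γ_i))`. -/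
def IsTwoHiddenLayerReLU {d : ℕ} (T : EuclideanSpace ℝ (Fin d) → ℝ) : Prop :=
  ∃ (m₁ m₂ : ℕ) (c : ℝ) (lam b : Fin m₂ → ℝ) (w : Fin m₂ → Fin m₁ → ℝ)
    (β : Fin m₁ → EuclideanSpace ℝ (Fin d)) (γ : Fin m₁ → ℝ),
    ∀ x, T x = c + ∑ j, lam j * max 0 (b j + ∑ i, w j i * max 0 (⟪β i, x⟫ + γ i))

/-- One-hidden-layer ReLU networks. -/
def IsOneLayer {d : ℕ} (g : EuclideanSpace ℝ (Fin d) → ℝ) : Prop :=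
  ∃ (m : ℕ) (c : ℝ) (w : Fin m → ℝ) (β : Fin m → EuclideanSpace ℝ (Fin d)) (γ : Fin m → ℝ),
    ∀ x, g x = c + ∑ i, w i * max 0 (⟪β i, x⟫ + γ i)

lemma IsOneLayer.const {d : ℕ} (c : ℝ) :
    IsOneLayer (fun _ : EuclideanSpace ℝ (Fin d) => c) :=
  ⟨0, c, Fin.elim0, Fin.elim0, Fin.elim0, fun x => by simp⟩

lemma IsOneLayer.relu {d : ℕ} (β : EuclideanSpace ℝ (Fin d)) (γ : ℝ) :
    IsOneLayer (fun x => max 0 (⟪β, x⟫ + γ)) :=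
  ⟨1, 0, fun _ => 1, fun _ => β, fun _ => γ, fun x => by simp⟩

lemma IsOneLayer.add {d : ℕ} {f g : EuclideanSpace ℝ (Fin d) → ℝ}
    (hf : IsOneLayer f) (hg : IsOneLayer g) : IsOneLayer (fun x => f x + g x) := by
  obtain ⟨m, c, w, β, γ, h⟩ := hf
  obtain ⟨m', c', w', β', γ', h'⟩ := hg
  refine ⟨m + m', c + c', Fin.append w w', Fin.append β β', Fin.append γ γ', fun x => ?_⟩
  beta_reduce
  rw [h, h', Fin.sum_univ_add]
  simp only [Fin.append_left, Fin.append_right]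
  ring

lemma IsOneLayer.smul {d : ℕ} {f : EuclideanSpace ℝ (Fin d) → ℝ} (a : ℝ)
    (hf : IsOneLayer f) : IsOneLayer (fun x => a * f x) := by
  obtain ⟨m, c, w, β, γ, h⟩ := hf
  refine ⟨m, a * c, fun i => a * w i, β, γ, fun x => ?_⟩
  beta_reduce
  rw [h, mul_add, Finset.mul_sum]
  simp only [mul_assoc]

/-- Piecewise linear interpolation along a direction. -/
lemma ridge_step {d : ℕ} (β : EuclideanSpace ℝ (Fin d)) (h : ℝ → ℝ) (a δ η : ℝ) (hδ : 0 < δ)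
    (N : ℕ)
    (hη : ∀ s t, a ≤ s → s ≤ a + N * δ → a ≤ t → t ≤ a + N * δ → |s - t| ≤ δ →
      |h s - h t| ≤ η) (n : ℕ) (hn : n ≤ N) :
    ∃ g : EuclideanSpace ℝ (Fin d) → ℝ, IsOneLayer g ∧
      (∀ x, a ≤ ⟪β, x⟫ → ⟪β, x⟫ ≤ a + n * δ → |g x - h ⟪β, x⟫| ≤ η) ∧
      ∀ x, a + n * δ ≤ ⟪β, x⟫ → g x = h (a + n * δ) := by
  induction n with
  | zero =>
    refine ⟨_, IsOneLayer.const (h a), ?_, ?_⟩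
    · intro x h1 h2
      have : ⟪β, x⟫ = a := by simp at h2; linarith
      have h3 := hη a a le_rfl (by have : 0 ≤ (N : ℝ) * δ := by positivity
                                   linarith) le_rfl
        (by have : 0 ≤ (N : ℝ) * δ := by positivity
            linarith) (by simp; exact hδ.le)
      rw [this]; exact h3
    · intro x _
      simp
  | succ n ih =>
    obtain ⟨g, hg, h1, h2⟩ := ih (by omega)
    set p := a + n * δ with hp
    have hq : a + ((n + 1 : ℕ) : ℝ) * δ = p + δ := by rw [hp]; push_cast; ring
    have hnN : p + δ ≤ a + N * δ := by
      rw [← hq]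
      have : ((n + 1 : ℕ) : ℝ) ≤ N := by exact_mod_cast hn
      nlinarith
    have hap : a ≤ p := by
      have : 0 ≤ (n : ℝ) * δ := by positivity
      linarith
    rw [hq]
    set D := (h (p + δ) - h p) / δ with hD
    have hDδ : D * δ = h (p + δ) - h p := by rw [hD]; field_simp
    refine ⟨_, hg.add (((IsOneLayer.relu β (-p)).smul D).add
      ((IsOneLayer.relu β (-(p + δ))).smul (-D))), ?_, ?_⟩
    · intro x hx1 hx2
      beta_reduce
      rw [max_eq_left (a := (0 : ℝ)) (b := ⟪β, x⟫ + -(p + δ)) (by linarith)]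
      by_cases hc : ⟪β, x⟫ ≤ p
      · rw [max_eq_left (by linarith)]
        simpa using h1 x hx1 hc
      · push Not at hc
        rw [max_eq_right (by linarith), h2 x hc.le]
        set t := ⟪β, x⟫
        have e1 := abs_le.1 (hη p t hap (by linarith) hx1 (by linarith)
          (by rw [abs_le]; constructor <;> linarith))
        have e2 := abs_le.1 (hη (p + δ) t (by linarith) hnN hx1 (by linarith)
          (by rw [abs_le]; constructor <;> linarith))
        obtain ⟨r, hr⟩ : ∃ r, r * δ = t - p := ⟨(t - p) / δ, by field_simp⟩
        have hr0 : 0 ≤ r := by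
          by_contra hh
          push Not at hh
          nlinarith
        have hr1 : r ≤ 1 := by
          by_contra hh
          push Not at hh
          nlinarith
        have : h p + (D * (t + -p) + -D * 0) - h t
            = (1 - r) * (h p - h t) + r * (h (p + δ) - h t) := by
          have : D * (t + -p) = r * (h (p + δ) - h p) := by
            rw [← hDδ]
            linear_combination (-D) * hr
          rw [this]; ring
        rw [this, abs_le]
        constructor <;> nlinarith
    · intro x hx
      beta_reduce
      rw [h2 x (by linarith), max_eq_right (by linarith), max_eq_right (by linarith)]
      linear_combination hDδ

lemma ridge_approx {d : ℕ} (K : Set (EuclideanSpace ℝ (Fin d))) (hK : IsCompact K)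
    (β : EuclideanSpace ℝ (Fin d)) (h : ℝ → ℝ) (hh : Continuous h) (η : ℝ) (hη : 0 < η) :
    ∃ g : EuclideanSpace ℝ (Fin d) → ℝ, IsOneLayer g ∧ ∀ x ∈ K, |g x - h ⟪β, x⟫| ≤ η := by
  obtain ⟨R, hR⟩ := (hK.image (f := fun x => ⟪β, x⟫) (by fun_prop)).isBounded.subset_closedBall 0
  have hR' : ∀ x ∈ K, |⟪β, x⟫| ≤ |R| := by
    intro x hx
    have := hR ⟨x, hx, rfl⟩
    simp only [Metric.mem_closedBall, Real.dist_eq, sub_zero] at this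
    exact this.trans (le_abs_self R)
  have huc := (isCompact_Icc (a := -|R|) (b := |R| + 1)).uniformContinuousOn_of_continuous
    hh.continuousOn
  rw [Metric.uniformContinuousOn_iff] at huc
  obtain ⟨δ₀, hδ₀, H⟩ := huc η hη
  obtain ⟨N, hN⟩ := exists_nat_gt ((2 * |R| + 1) / δ₀)
  have hpos : 0 < 2 * |R| + 1 := by positivity
  have hN0 : (0 : ℝ) < N := lt_trans (by positivity) hN
  obtain ⟨δ, hδ⟩ : ∃ δ, δ = (2 * |R| + 1) / N := ⟨_, rfl⟩
  have hδ0 : 0 < δ := by rw [hδ]; positivity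
  have hNδ : N * δ = 2 * |R| + 1 := by rw [hδ]; field_simp
  have hδlt : δ < δ₀ := by
    rw [hδ, div_lt_iff₀ hN0]
    rw [div_lt_iff₀ hδ₀] at hN
    linarith
  obtain ⟨g, hg, h1, -⟩ := ridge_step β h (-|R|) δ η hδ0 N (by
    intro s t hs hs' ht ht' hst
    rw [hNδ] at hs' ht'
    have := H s ⟨hs, by linarith⟩ t ⟨ht, by linarith⟩ (by rw [Real.dist_eq]; linarith)
    rw [Real.dist_eq] at this
    exact this.le) N le_rfl
  refine ⟨g, hg, fun x hx => h1 x ?_ ?_⟩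
  · exact (abs_le.1 (hR' x hx)).1
  · rw [hNδ]
    have := (abs_le.1 (hR' x hx)).2
    linarith

/-- The exponential characters restricted to `K`. -/
noncomputable def expHom {d : ℕ} (K : Set (EuclideanSpace ℝ (Fin d))) :
    Multiplicative (EuclideanSpace ℝ (Fin d)) →* C(K, ℝ) where
  toFun β := ⟨fun x => Real.exp ⟪β.toAdd, (x : EuclideanSpace ℝ (Fin d))⟫, by fun_prop⟩
  map_one' := by ext x; simp
  map_mul' β β' := by ext x; simp [inner_add_left, Real.exp_add]

lemma compact_approx {d : ℕ} (K : Set (EuclideanSpace ℝ (Fin d))) (hK : IsCompact K)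
    (f : EuclideanSpace ℝ (Fin d) → ℝ) (hf : Continuous f) (η : ℝ) (hη : 0 < η) :
    ∃ g : EuclideanSpace ℝ (Fin d) → ℝ, IsOneLayer g ∧ ∀ x ∈ K, |g x - f x| ≤ η := by
  have : CompactSpace K := isCompact_iff_compactSpace.1 hK
  set A : Subalgebra ℝ C(K, ℝ) :=
    Algebra.adjoin ℝ ((MonoidHom.mrange (expHom K) : Submonoid C(K, ℝ)) : Set C(K, ℝ)) with hA
  have hsep : A.SeparatesPoints := by
    intro x y hxy
    have hxy' : (x : EuclideanSpace ℝ (Fin d)) - y ≠ 0 := by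
      intro h
      exact hxy (Subtype.ext (sub_eq_zero.1 h))
    refine ⟨_, ⟨expHom K (Multiplicative.ofAdd ((x : EuclideanSpace ℝ (Fin d)) - y)),
      Algebra.subset_adjoin ⟨_, rfl⟩, rfl⟩, ?_⟩
    intro h
    have h' := Real.exp_injective h
    simp only [toAdd_ofAdd] at h'
    apply hxy'
    rw [← inner_self_eq_zero (𝕜 := ℝ), inner_sub_right]
    linarith
  have key : ∀ u ∈ A, ∀ η : ℝ, 0 < η → ∃ g : EuclideanSpace ℝ (Fin d) → ℝ, IsOneLayer g ∧
      ∀ x : K, |g x - u x| ≤ η := by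
    intro u hu
    have hu' : u ∈ Subalgebra.toSubmodule A := hu
    rw [hA, Algebra.adjoin_eq_span, Submonoid.closure_eq] at hu'
    clear hu
    induction hu' using Submodule.span_induction with
    | mem u hu =>
      obtain ⟨β, rfl⟩ := hu
      intro η hη
      obtain ⟨g, hg, h⟩ := ridge_approx K hK β.toAdd Real.exp Real.continuous_exp η hη
      exact ⟨g, hg, fun x => h x x.2⟩
    | zero =>
      intro η hη
      exact ⟨_, IsOneLayer.const 0, fun x => by simpa using hη.le⟩
    | add u v hu hv ihu ihv =>
      intro η hη
      obtain ⟨g, hg, h⟩ := ihu (η / 2) (by positivity)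
      obtain ⟨g', hg', h'⟩ := ihv (η / 2) (by positivity)
      refine ⟨_, hg.add hg', fun x => ?_⟩
      have e1 := abs_le.1 (h x)
      have e2 := abs_le.1 (h' x)
      rw [ContinuousMap.add_apply, abs_le]
      constructor <;> linarith
    | smul a u hu ihu =>
      intro η hη
      obtain ⟨g, hg, h⟩ := ihu (η / (|a| + 1)) (by positivity)
      refine ⟨_, hg.smul a, fun x => ?_⟩
      rw [ContinuousMap.smul_apply, smul_eq_mul, ← mul_sub, abs_mul]
      calc |a| * |g x - u x| ≤ (|a| + 1) * (η / (|a| + 1)) := by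
            gcongr
            · linarith
            · exact h x
        _ = η := by field_simp
  obtain ⟨u, hu⟩ := ContinuousMap.exists_mem_subalgebra_near_continuousMap_of_separatesPoints
    A hsep ⟨fun x : K => f x, by fun_prop⟩ (η / 2) (by positivity)
  obtain ⟨g, hg, h⟩ := key u u.2 (η / 2) (by positivity)
  refine ⟨g, hg, fun x hx => ?_⟩
  have e1 := abs_le.1 (h ⟨x, hx⟩)
  have e2 := abs_le.1 ((ContinuousMap.norm_coe_le_norm _ (⟨x, hx⟩ : K)).trans hu.le)
  simp only [ContinuousMap.sub_apply, ContinuousMap.coe_mk] at e1 e2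
  rw [abs_le]
  constructor <;> linarith

lemma bounded_case {d : ℕ} (P : Measure (EuclideanSpace ℝ (Fin d))) [IsProbabilityMeasure P]
    (f : EuclideanSpace ℝ (Fin d) → ℝ) (hf : Continuous f)
    (ε : ℝ) (hε : 0 < ε) (M : ℝ) (hM : 1 ≤ M) (hfM : ∀ x, |f x| ≤ M - 1) :
    ∃ T : EuclideanSpace ℝ (Fin d) → ℝ, IsTwoHiddenLayerReLU T ∧
      (∫ x, |f x - T x| ∂P < ε) ∧ ∀ x, |T x| ≤ M := by
  have hδ : 0 < ε / (8 * M) := by positivity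
  obtain ⟨K, -, hK, hPK⟩ := MeasurableSet.univ.exists_isCompact_diff_lt (μ := P) (by simp)
    (ε := ENNReal.ofReal (ε / (8 * M))) (by simpa using hδ)
  obtain ⟨g, hg, hgf⟩ := compact_approx K hK f hf (ε / 4) (by positivity)
  obtain ⟨m, c, w, β, γ, hgx⟩ := hg
  have hcont : Continuous g := by
    have : g = fun x => c + ∑ i, w i * max 0 (⟪β i, x⟫ + γ i) := funext hgx
    rw [this]
    fun_prop
  let T : EuclideanSpace ℝ (Fin d) → ℝ := fun x => -M + (max 0 (g x + M) - max 0 (g x - M))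
  have hTc : Continuous T := by fun_prop
  have hTM : ∀ x, |T x| ≤ M := by
    intro x
    simp only [T]
    rw [abs_le]
    rcases max_cases 0 (g x + M) with ⟨h, h'⟩ | ⟨h, h'⟩ <;>
    rcases max_cases 0 (g x - M) with ⟨k, k'⟩ | ⟨k, k'⟩ <;> rw [h, k] <;>
    constructor <;> linarith
  have hTK : ∀ x ∈ K, |f x - T x| ≤ ε / 4 := by
    intro x hx
    have e1 := abs_le.1 (hgf x hx)
    have e2 := abs_le.1 (hfM x)
    simp only [T]
    rw [abs_le]
    rcases max_cases 0 (g x + M) with ⟨h, h'⟩ | ⟨h, h'⟩ <;>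
    rcases max_cases 0 (g x - M) with ⟨k, k'⟩ | ⟨k, k'⟩ <;> rw [h, k] <;>
    constructor <;> linarith
  refine ⟨T, ?_, ?_, hTM⟩
  · refine ⟨m, 2, -M, ![1, -1], ![c + M, c - M], fun _ => w, β, γ, fun x => ?_⟩
    simp only [T, Fin.sum_univ_two, Matrix.cons_val_zero, Matrix.cons_val_one, hgx]
    rw [show c + ∑ i, w i * max 0 (⟪β i, x⟫ + γ i) + M
      = c + M + ∑ i, w i * max 0 (⟪β i, x⟫ + γ i) by ring,
      show c + ∑ i, w i * max 0 (⟪β i, x⟫ + γ i) - M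
      = c - M + ∑ i, w i * max 0 (⟪β i, x⟫ + γ i) by ring]
    ring
  · have hb : ∀ x, |f x - T x| ≤ ε / 4 + Kᶜ.indicator (fun _ => 2 * M) x := by
      intro x
      by_cases hx : x ∈ K
      · simpa [hx] using hTK x hx
      · have e1 := abs_le.1 (hTM x)
        have e2 := abs_le.1 (hfM x)
        simp only [Set.indicator, Set.mem_compl_iff, hx, not_false_eq_true, if_true]
        rw [abs_le]
        constructor <;> linarith
    have hi1 : Integrable (Kᶜ.indicator (fun _ => 2 * M)) P :=
      (integrable_const _).indicator hK.measurableSet.compl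
    have hi : Integrable (fun x => ε / 4 + Kᶜ.indicator (fun _ => 2 * M) x) P :=
      (integrable_const _).add hi1
    have hle : ∫ x, |f x - T x| ∂P ≤ ∫ x, (ε / 4 + Kᶜ.indicator (fun _ => 2 * M) x) ∂P :=
      integral_mono_of_nonneg (Filter.Eventually.of_forall fun x => abs_nonneg _) hi
        (Filter.Eventually.of_forall hb)
    rw [integral_add (integrable_const _) hi1, integral_indicator_const _ hK.measurableSet.compl]
      at hle
    have hreal : P.real Kᶜ ≤ ε / (8 * M) := by
      rw [← Set.compl_eq_univ_sdiff] at hPK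
      exact ENNReal.toReal_le_of_le_ofReal hδ.le hPK.le
    have : P.real Kᶜ * (2 * M) ≤ ε / 4 := by
      calc P.real Kᶜ * (2 * M) ≤ ε / (8 * M) * (2 * M) := by gcongr
        _ = ε / 4 := by field_simp; norm_num
    simp only [integral_const, probReal_univ, smul_eq_mul, one_mul] at hle
    linarith

/-- L¹(P) universal approximation of bounded continuous functions by
two-hidden-layer ReLU networks, with preserved boundedness: if `|f| ≤ M' − 1` then the
approximating network can be chosen with `|T| ≤ M'`. -/
theorem relu_universal_approximation_L1
    {d : ℕ} (P : Measure (EuclideanSpace ℝ (Fin d))) [IsProbabilityMeasure P]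
    (f : EuclideanSpace ℝ (Fin d) → ℝ) (hf : Continuous f)
    (hfb : ∃ C : ℝ, ∀ x, |f x| ≤ C)
    (ε : ℝ) (hε : 0 < ε) :
    (∃ T : EuclideanSpace ℝ (Fin d) → ℝ, IsTwoHiddenLayerReLU T ∧
        ∫ x, |f x - T x| ∂P < ε)
      ∧ ∀ M' : ℝ, 1 ≤ M' → (∀ x, |f x| ≤ M' - 1) →
          ∃ T : EuclideanSpace ℝ (Fin d) → ℝ, IsTwoHiddenLayerReLU T ∧
            (∫ x, |f x - T x| ∂P < ε) ∧ ∀ x, |T x| ≤ M' := by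
  refine ⟨?_, fun M' hM hfM => bounded_case P f hf ε hε M' hM hfM⟩
  obtain ⟨C, hC⟩ := hfb
  have hC0 : 0 ≤ C := (abs_nonneg _).trans (hC 0)
  obtain ⟨T, h1, h2, -⟩ := bounded_case P f hf ε hε (C + 1) (by linarith)
    (fun x => by simpa using hC x)
  exact ⟨T, h1, h2⟩
end

section
/- Let P and Q be probability measures on ℝ^d, absolutely continuous with respect to Lebesgue measure with densities p and q respectively, with P ≪ Q. Suppose the differential entropy H(P) = −E^P[log p] is finite and log q is P-integrable. Then for every measurable T : ℝ^d → ℝ that is P-integrable with E^Q[e^T] ∈ (0, ∞), one has H(P) ≤ −E^P[log q] − ( E^P[T] − log E^Q[e^T] ). -/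
open MeasureTheory

/-- REMEDI upper bound on the differential entropy: if `P, Q` have Lebesgue
densities `p, q`, `P ≪ Q`, `H(P) = −E^P[log p]` is finite and `log q` is `P`-integrable, then
for every measurable, `P`-integrable `T` with `E^Q[e^T] ∈ (0,∞)`,
`H(P) ≤ −E^P[log q] − (E^P[T] − log E^Q[e^T])`. -/
theorem differential_entropy_le_remedi_loss
    {d : ℕ} (P Q : Measure (EuclideanSpace ℝ (Fin d)))
    [IsProbabilityMeasure P] [IsProbabilityMeasure Q]
    (p q : EuclideanSpace ℝ (Fin d) → ℝ)
    (hpmeas : Measurable p) (hqmeas : Measurable q)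
    (hp0 : ∀ x, 0 ≤ p x) (hq0 : ∀ x, 0 ≤ q x)
    (hP : P = volume.withDensity (fun x => ENNReal.ofReal (p x)))
    (hQ : Q = volume.withDensity (fun x => ENNReal.ofReal (q x)))
    (hPQ : P ≪ Q)
    (hlogp : Integrable (fun x => Real.log (p x)) P)
    (hlogq : Integrable (fun x => Real.log (q x)) P)
    (T : EuclideanSpace ℝ (Fin d) → ℝ) (hTmeas : Measurable T)
    (hTint : Integrable T P)
    (heT : Integrable (fun x => Real.exp (T x)) Q)
    (hZpos : 0 < ∫ x, Real.exp (T x) ∂Q) :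
    -∫ x, Real.log (p x) ∂P
      ≤ -(∫ x, Real.log (q x) ∂P)
        - ((∫ x, T x ∂P) - Real.log (∫ x, Real.exp (T x) ∂Q)) := by
  set Z := ∫ x, Real.exp (T x) ∂Q with hZ
  have hpm : Measurable (fun x => ENNReal.ofReal (p x)) := hpmeas.ennreal_ofReal
  have hqm : Measurable (fun x => ENNReal.ofReal (q x)) := hqmeas.ennreal_ofReal
  have hpp : ∀ᵐ x ∂P, 0 < p x := by
    rw [hP, ae_withDensity_iff hpm]
    refine Filter.Eventually.of_forall fun x hx => ?_
    simpa using hx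
  have hqp : ∀ᵐ x ∂P, 0 < q x := by
    apply hPQ.ae_le
    change ∀ᵐ x ∂Q, 0 < q x
    rw [hQ, ae_withDensity_iff hqm]
    refine Filter.Eventually.of_forall fun x hx => ?_
    simpa using hx
  have hqI : Integrable (fun x => q x * Real.exp (T x)) volume := by
    rw [hQ, integrable_withDensity_iff_integrable_smul' hqm (by simp)] at heT
    simpa [ENNReal.toReal_ofReal, hq0] using heT
  have hZq : Z = ∫ x, q x * Real.exp (T x) := by
    rw [hZ, hQ, integral_withDensity_eq_integral_toReal_smul hqm (by simp)]
    simp [ENNReal.toReal_ofReal, hq0]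
  have hle : ∀ x, p x * (Real.exp (T x) * q x / p x) ≤ q x * Real.exp (T x) := by
    intro x
    rcases (hp0 x).eq_or_lt with h | h
    · rw [← h, zero_mul]
      exact mul_nonneg (hq0 x) (Real.exp_pos _).le
    · apply le_of_eq
      field_simp
  have hfI' : Integrable (fun x => p x * (Real.exp (T x) * q x / p x)) volume := by
    refine hqI.mono' (by fun_prop) (Filter.Eventually.of_forall fun x => ?_)
    rw [Real.norm_of_nonneg]
    · exact hle x
    · have := hp0 x
      have := hq0 x
      positivity
  have hfI : Integrable (fun x => Real.exp (T x) * q x / p x) P := by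
    rw [hP, integrable_withDensity_iff_integrable_smul' hpm (by simp)]
    simpa [ENNReal.toReal_ofReal, hp0] using hfI'
  have hfZ : ∫ x, Real.exp (T x) * q x / p x ∂P ≤ Z := by
    rw [hZq, hP, integral_withDensity_eq_integral_toReal_smul hpm (by simp)]
    simp only [ENNReal.toReal_ofReal, hp0, smul_eq_mul]
    exact integral_mono hfI' hqI hle
  have key : ∫ x, (T x + Real.log (q x) - Real.log (p x) - Real.log Z) ∂P
      ≤ ∫ x, ((Real.exp (T x) * q x / p x) / Z - 1) ∂P := by
    refine integral_mono_ae (((hTint.add hlogq).sub hlogp).sub (integrable_const _))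
      ((hfI.div_const Z).sub (integrable_const _)) ?_
    filter_upwards [hpp, hqp] with x h1 h2
    have h3 : Real.log ((Real.exp (T x) * q x / p x) / Z)
        = T x + Real.log (q x) - Real.log (p x) - Real.log Z := by
      rw [Real.log_div (by positivity) hZpos.ne', Real.log_div (by positivity) h1.ne',
        Real.log_mul (by positivity) h2.ne', Real.log_exp]
    rw [← h3]
    exact Real.log_le_sub_one_of_pos (by positivity)
  have hI1 : Integrable (fun x => T x + Real.log (q x)) P := hTint.add hlogq
  have hI2 : Integrable (fun x => T x + Real.log (q x) - Real.log (p x)) P := hI1.sub hlogp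
  rw [integral_sub hI2 (integrable_const _),
    integral_sub hI1 hlogp, integral_add hTint hlogq,
    integral_sub (hfI.div_const Z) (integrable_const _), integral_div] at key
  simp only [integral_const, probReal_univ, one_smul] at key
  have h4 : (∫ x, Real.exp (T x) * q x / p x ∂P) / Z ≤ 1 := (div_le_one hZpos).2 hfZ
  linarith
end
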